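/- Let h, σ : [0,1) → ℝ be of class C¹ with σ > 0, let y ∈ ℝ, and define the drift b_y(t,z) := h(t)·(y − z). Define the reciprocal characteristic of a drift b and diffusion coefficient ρ by F_{b,ρ}(t,z) := ∂_t(b/ρ²)(t,z) + (1/2)·∂_z( (b/ρ)²(t,z) + ρ²(t,z)·∂_z(b/ρ²)(t,z) ). Then for ρ(t,z) = σ(t), one has the explicit formula F_{b_y,σ}(t,z) = [ ( h'(t)·σ(t)² − h(t)·(σ²)'(t) − h(t)²·σ(t)² ) / σ(t)⁴ ]·(y − z) for all (t,z) ∈ [0,1) × ℝ. Consequently, F_{b_y,σ}(t,z) takes the same value for all y ∈ ℝ (at every fixed (t,z)) if and only if h'(t) = h(t)² + h(t)·(σ²)'(t)/σ(t)² for all t ∈ [0,1). (This computation is the core of the proof of Theorem 6.) -/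

import Mathlib

open Filter Topology Set

/-- The reciprocal characteristic `F_{b,ρ}` of a drift `b(t,z)` and diffusion coefficient
`ρ(t,z)` on `[0,1) × ℝ`:
`F_{b,ρ}(t,z) = ∂_t(b/ρ²)(t,z) + (1/2)·∂_z((b/ρ)²(t,z) + ρ²(t,z)·∂_z(b/ρ²)(t,z))`.
The time derivative is taken within `[0,1)`. -/
noncomputable def reciprocalChar (b ρ : ℝ → ℝ → ℝ) (t z : ℝ) : ℝ :=
  derivWithin (fun t' => b t' z / (ρ t' z) ^ 2) (Set.Ico 0 1) t
    + (1 / 2) * deriv (fun z' =>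
        (b t z' / ρ t z') ^ 2
          + (ρ t z') ^ 2 * deriv (fun z'' => b t z'' / (ρ t z'') ^ 2) z') z

theorem reciprocalChar_linear_drift {h σ : ℝ → ℝ} {t dh dσ2 : ℝ} (ht : t ∈ Set.Ico (0:ℝ) 1)
    (hσ : σ t ≠ 0) (hh : HasDerivWithinAt h dh (Set.Ico 0 1) t)
    (hσ2 : HasDerivWithinAt (fun s => (σ s) ^ 2) dσ2 (Set.Ico 0 1) t) (y z : ℝ) :
    reciprocalChar (fun t' z' => h t' * (y - z')) (fun t' _ => σ t') t z
      = ((dh * (σ t) ^ 2 - h t * dσ2 - (h t) ^ 2 * (σ t) ^ 2) / (σ t) ^ 4) * (y - z) := by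
  have htime : derivWithin (fun t' => h t' * (y - z) / (σ t') ^ 2) (Set.Ico 0 1) t
      = (dh * (y - z) * (σ t) ^ 2 - h t * (y - z) * dσ2) / ((σ t) ^ 2) ^ 2 :=
    ((hh.mul_const (y - z)).fun_div hσ2 (pow_ne_zero 2 hσ)).derivWithin
      (uniqueDiffOn_Ico 0 1 t ht)
  have hlin : ∀ x : ℝ, HasDerivAt (fun x' => h t * (y - x')) (h t * -1) x := fun x =>
    ((hasDerivAt_id x).const_sub y).const_mul (h t)
  have hinner : ∀ x : ℝ, deriv (fun x' => h t * (y - x') / (σ t) ^ 2) x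
      = h t * -1 / (σ t) ^ 2 := fun x => ((hlin x).div_const _).deriv
  have hspace := (((hlin z).div_const (σ t)).fun_pow 2).add_const
    ((σ t) ^ 2 * (h t * -1 / (σ t) ^ 2))
  simp only [reciprocalChar, hinner]
  rw [htime, hspace.deriv, Nat.add_one_sub_one, pow_one]
  push_cast
  field_simp
  ring

/-- Core computation of the proof of Theorem 6: for the drift `b_y(t,z) = h(t)(y − z)` and
diffusion coefficient `ρ(t,z) = σ(t)` (with `h, σ` of class `C¹` on `[0,1)` and `σ > 0`),
`F_{b_y,σ}(t,z) = ((h'σ² − h(σ²)' − h²σ²)/σ⁴)·(y − z)`; consequently `F_{b_y,σ}(t,z)` is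
independent of `y` if and only if `h' = h² + h·(σ²)'/σ²` on `[0,1)`. -/
theorem reciprocal_characteristics_computation
    (h σ h' σ2' : ℝ → ℝ)
    (hσpos : ∀ t ∈ Set.Ico (0:ℝ) 1, 0 < σ t)
    -- `h` and `σ²` are differentiable on `[0,1)` with continuous derivatives `h'` and `(σ²)'`
    (hhderiv : ∀ t ∈ Set.Ico (0:ℝ) 1, HasDerivWithinAt h (h' t) (Set.Ico 0 1) t)
    (hσ2deriv : ∀ t ∈ Set.Ico (0:ℝ) 1,
      HasDerivWithinAt (fun s => (σ s) ^ 2) (σ2' t) (Set.Ico 0 1) t)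
    (hh'cont : ContinuousOn h' (Set.Ico 0 1))
    (hσcont : ContinuousOn σ (Set.Ico 0 1))
    (hσ2'cont : ContinuousOn σ2' (Set.Ico 0 1)) :
    (∀ y : ℝ, ∀ t ∈ Set.Ico (0:ℝ) 1, ∀ z : ℝ,
      reciprocalChar (fun t' z' => h t' * (y - z')) (fun t' _ => σ t') t z
        = ((h' t * (σ t) ^ 2 - h t * σ2' t - (h t) ^ 2 * (σ t) ^ 2) / (σ t) ^ 4) * (y - z)) ∧
    ((∀ t ∈ Set.Ico (0:ℝ) 1, ∀ z y₁ y₂ : ℝ,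
        reciprocalChar (fun t' z' => h t' * (y₁ - z')) (fun t' _ => σ t') t z
          = reciprocalChar (fun t' z' => h t' * (y₂ - z')) (fun t' _ => σ t') t z)
      ↔ (∀ t ∈ Set.Ico (0:ℝ) 1, h' t = (h t) ^ 2 + h t * σ2' t / (σ t) ^ 2)) := by
  have formula : ∀ y : ℝ, ∀ t ∈ Set.Ico (0:ℝ) 1, ∀ z : ℝ,
      reciprocalChar (fun t' z' => h t' * (y - z')) (fun t' _ => σ t') t z
        = ((h' t * (σ t) ^ 2 - h t * σ2' t - (h t) ^ 2 * (σ t) ^ 2) / (σ t) ^ 4) * (y - z) :=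
    fun y t ht z =>
      reciprocalChar_linear_drift ht (hσpos t ht).ne' (hhderiv t ht) (hσ2deriv t ht) y z
  refine ⟨formula, forall₂_congr fun t ht => ?_⟩
  have hσ : σ t ≠ 0 := (hσpos t ht).ne'
  simp only [formula _ t ht]
  constructor
  · intro hindep
    have hzero := hindep 0 1 0
    rw [sub_zero, sub_zero, mul_one, mul_zero, div_eq_zero_iff,
      or_iff_left (pow_ne_zero 4 hσ)] at hzero
    field_simp
    linarith
  · intro hode z y₁ y₂
    have hzero : h' t * (σ t) ^ 2 - h t * σ2' t - (h t) ^ 2 * (σ t) ^ 2 = 0 := by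
      rw [hode]
      field_simp
      ring
    simp [hzero]
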